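/- arXiv:2411.16061 — 4 statements merged into one kernel-verified Lean document; each statement's English description precedes it below -/
import Mathlib

section
/- For every real number u and every positive integer D, the total number of spikes fired by the single-input IF-SR neuron with initial membrane potential u over the first D timesteps equals the floor of the clipped potential: ∑_{d=1}^{D} s_d = ⌊min(max(u,0), D)⌋. -/
/-- For every real `u` and every positive integer `D`, the total number of
spikes fired by the single-input IF-SR neuron (threshold 1, initial membrane potential `u`,
zero input at later timesteps) over the first `D` timesteps equals
`⌊min (max u 0) D⌋`. -/
theorem ifsr_spike_count_eq_floor_clip
    (u : ℝ) (D : ℕ) (hD : 0 < D)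
    (h s : ℕ → ℝ)
    (h0 : h 0 = u)
    (hs : ∀ d : ℕ, 1 ≤ d → s d = if 1 ≤ h (d - 1) then 1 else 0)
    (hh : ∀ d : ℕ, 1 ≤ d → h d = h (d - 1) - s d) :
    ∑ d ∈ Finset.Icc 1 D, s d = (⌊min (max u 0) (D : ℝ)⌋ : ℝ) := by
  have key : ∀ n : ℕ, ∃ k : ℤ, ∑ d ∈ Finset.Icc 1 n, s d = (k : ℝ) ∧ h n = u - k ∧ 0 ≤ k ∧
      k ≤ n ∧ (k = n ∨ h n < 1) ∧ (k = 0 ∨ 0 ≤ h n) := by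
    intro n
    induction n with
    | zero => exact ⟨0, by simp [h0]⟩
    | succ n ih =>
      obtain ⟨k, h1, h2, h3, h4, h5, h6⟩ := ih
      have e1 := hs (n + 1) (by omega)
      have e2 := hh (n + 1) (by omega)
      simp only [Nat.add_sub_cancel] at e1 e2
      rw [Finset.sum_Icc_succ_top (by omega), h1]
      by_cases hc : 1 ≤ h n
      · rw [if_pos hc] at e1
        refine ⟨k + 1, by rw [e1]; push_cast; ring, by rw [e2, e1, h2]; push_cast; ring,
          by omega, by push_cast; omega, Or.inl ?_, Or.inr (by rw [e2, e1]; linarith)⟩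
        rcases h5 with h5 | h5
        · rw [h5]; push_cast; ring
        · linarith
      · rw [if_neg hc] at e1
        rw [e1, sub_zero] at e2
        refine ⟨k, by rw [e1]; ring, by rw [e2, h2], h3, by push_cast; omega,
          Or.inr (by rw [e2]; linarith), by rw [e2]; exact h6⟩
  obtain ⟨k, h1, h2, h3, h4, h5, h6⟩ := key D
  have h3' : (0 : ℝ) ≤ k := by exact_mod_cast h3
  have h4' : (k : ℝ) ≤ D := by exact_mod_cast h4
  have hf : ⌊min (max u 0) (D : ℝ)⌋ = k := by
    rw [Int.floor_eq_iff]
    constructor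
    · refine le_min ?_ h4'
      rcases h6 with h6 | h6
      · simp [h6]
      · exact le_max_of_le_left (by linarith)
    · rcases h5 with h5 | h5
      · have h5' : (k : ℝ) = D := by exact_mod_cast h5
        exact min_lt_of_right_lt (by linarith)
      · exact min_lt_of_left_lt (max_lt (by linarith) (by linarith))
  rw [h1, hf]
end

section
/- For every real number u and every integer d ≥ 1, the single-input IF-SR neuron with initial membrane potential u fires at timestep d if and only if u ≥ d; in particular the spike train consists of a consecutive prefix of timesteps (the neuron fires at the first ⌊max(u,0)⌋ timesteps and never again). -/
/-- For every real `u` and every integer `d ≥ 1`, the single-input IF-SR neuron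
with initial membrane potential `u` fires at timestep `d` iff `u ≥ d`; in particular the
spike train is a consecutive prefix: the neuron fires at exactly the first `⌊max u 0⌋`
timesteps and never again. -/
theorem ifsr_fires_iff_ge
    (u : ℝ)
    (h s : ℕ → ℝ)
    (h0 : h 0 = u)
    (hs : ∀ d : ℕ, 1 ≤ d → s d = if 1 ≤ h (d - 1) then 1 else 0)
    (hh : ∀ d : ℕ, 1 ≤ d → h d = h (d - 1) - s d) :
    (∀ d : ℕ, 1 ≤ d → (s d = 1 ↔ (d : ℝ) ≤ u)) ∧
    (∀ d : ℕ, 1 ≤ d → (s d = 1 ↔ (d : ℤ) ≤ ⌊max u 0⌋)) := by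
  have inv : ∀ n : ℕ, ((n : ℝ) ≤ u → h n = u - n) ∧ (u < n → h n < 1) := by
    intro n
    induction n with
    | zero =>
      refine ⟨fun _ => by simp [h0], fun hu => ?_⟩
      rw [h0]
      push_cast at hu
      linarith
    | succ n ih =>
      have e1 := hs (n + 1) (by omega)
      have e2 := hh (n + 1) (by omega)
      simp only [Nat.add_sub_cancel] at e1 e2
      obtain ⟨ih1, ih2⟩ := ih
      push_cast
      constructor
      · intro hu
        have a := ih1 (by linarith)
        rw [if_pos (by linarith)] at e1
        linarith
      · intro hu
        have b : h n < 1 := by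
          rcases le_or_gt (n : ℝ) u with c | c
          · have := ih1 c
            linarith
          · exact ih2 c
        rw [if_neg (by linarith)] at e1
        linarith
  have key : ∀ d : ℕ, 1 ≤ d → (s d = 1 ↔ (d : ℝ) ≤ u) := by
    intro d hd
    obtain ⟨n, rfl⟩ : ∃ n, d = n + 1 := ⟨d - 1, by omega⟩
    have e1 := hs (n + 1) (by omega)
    simp only [Nat.add_sub_cancel] at e1
    obtain ⟨i1, i2⟩ := inv n
    have : s (n + 1) = 1 ↔ 1 ≤ h n := by
      rw [e1]
      split_ifs with c <;> simp [c]
    rw [this]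
    push_cast
    constructor
    · intro c
      rcases le_or_gt (n : ℝ) u with k | k
      · have := i1 k
        linarith
      · have := i2 k
        linarith
    · intro c
      have := i1 (by linarith)
      linarith
  refine ⟨key, fun d hd => ?_⟩
  rw [key d hd, Int.le_floor, le_max_iff]
  push_cast
  have : (1 : ℝ) ≤ d := by exact_mod_cast hd
  constructor
  · exact Or.inl
  · rintro (c | c)
    · exact c
    · linarith
end

section
/- For every real number u and every integer d ≥ 0, the membrane potential of the single-input IF-SR neuron after d timesteps equals the initial potential minus the clipped-floor spike count: h_d = u − ⌊min(max(u,0), d)⌋. -/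
/-- For every real `u` and every `d ≥ 0`, the membrane potential of the
single-input IF-SR neuron after `d` timesteps satisfies
`h d = u - ⌊min (max u 0) d⌋`. -/
theorem ifsr_membrane_potential_eq
    (u : ℝ)
    (h s : ℕ → ℝ)
    (h0 : h 0 = u)
    (hs : ∀ d : ℕ, 1 ≤ d → s d = if 1 ≤ h (d - 1) then 1 else 0)
    (hh : ∀ d : ℕ, 1 ≤ d → h d = h (d - 1) - s d) :
    ∀ d : ℕ, h d = u - (⌊min (max u 0) (d : ℝ)⌋ : ℝ) := by
  intro d
  induction d with
  | zero => simp [h0]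
  | succ d ih =>
    have hd : (0:ℝ) ≤ d := Nat.cast_nonneg d
    have e1 := hh (d+1) (by omega)
    have e2 := hs (d+1) (by omega)
    simp only [Nat.add_sub_cancel] at e1 e2
    rw [e1, e2, ih]
    push_cast
    by_cases c : (d:ℝ) + 1 ≤ u
    · have m : max u 0 = u := max_eq_left (by linarith)
      have m1 : min u (d:ℝ) = d := min_eq_right (by linarith)
      have m2 : min u ((d:ℝ)+1) = d + 1 := min_eq_right c
      rw [m, m1, m2]
      have f1 : ⌊(d:ℝ)⌋ = (d:ℤ) := Int.floor_natCast d
      have f2 : ⌊(d:ℝ)+1⌋ = (d:ℤ)+1 := by rw [Int.floor_add_one, f1]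
      rw [f1, f2]
      push_cast
      rw [if_pos (by linarith)]
      ring
    · push Not at c
      have hm : max u 0 < (d:ℝ)+1 := max_lt c (by linarith)
      have m2 : min (max u 0) ((d:ℝ)+1) = max u 0 := min_eq_left hm.le
      have key : ⌊min (max u 0) (d:ℝ)⌋ = ⌊max u 0⌋ := by
        rcases le_total (max u 0) (d:ℝ) with c2 | c2
        · rw [min_eq_left c2]
        · rw [min_eq_right c2, Int.floor_natCast]
          symm
          rw [Int.floor_eq_iff]
          exact ⟨by exact_mod_cast c2, by exact_mod_cast hm⟩
      have := Int.lt_floor_add_one (max u 0)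
      have := le_max_left u 0
      rw [m2, key, if_neg (by linarith)]
      ring
end

section
/- Proposition 1 (equivalence of integer training and spike-train inference): for every real membrane potential u and every positive integer D, the integer activation Fire_D(u) = ⌊min(max(u,0), D)⌉ equals the total spike count ∑_{d=1}^{D} ŝ_d of the single-input IF-SR neuron with threshold 1 whose initial membrane potential is u + 1/2. -/
/-- Proposition 1: for every real membrane potential `u` and every positive
integer `D`, the integer activation `Fire_D u = ⌊min (max u 0) D⌉ = ⌊min (max u 0) D + 1/2⌋`
equals the total spike count over `D` timesteps of the single-input IF-SR neuron with
threshold 1 and initial membrane potential `u + 1/2`. -/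
theorem fire_eq_ifsr_spike_count
    (u : ℝ) (D : ℕ) (hD : 0 < D)
    (h s : ℕ → ℝ)
    (h0 : h 0 = u + 1 / 2)
    (hs : ∀ d : ℕ, 1 ≤ d → s d = if 1 ≤ h (d - 1) then 1 else 0)
    (hh : ∀ d : ℕ, 1 ≤ d → h d = h (d - 1) - s d) :
    (⌊min (max u 0) (D : ℝ) + 1 / 2⌋ : ℝ) = ∑ d ∈ Finset.Icc 1 D, s d := by
  have key : ∀ n : ℕ, ∃ k : ℕ, k ≤ n ∧ ∑ d ∈ Finset.Icc 1 n, s d = (k : ℝ) ∧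
      h n = u + 1 / 2 - k ∧ (k = 0 ∨ 0 ≤ h n) ∧ (k = n ∨ h n < 1) := by
    intro n
    induction n with
    | zero => exact ⟨0, le_rfl, by simp, by simp [h0], Or.inl rfl, Or.inl rfl⟩
    | succ n ih =>
      obtain ⟨k, hk, hsum, hn, ha, hb⟩ := ih
      have h1 := hs (n + 1) (by omega)
      have h2 := hh (n + 1) (by omega)
      simp only [Nat.add_sub_cancel] at h1 h2
      rw [Finset.sum_Icc_succ_top (by omega), hsum]
      by_cases hc : 1 ≤ h n
      · rw [if_pos hc] at h1
        refine ⟨k + 1, by omega, by rw [h1]; push_cast; ring, by rw [h2, h1, hn]; push_cast; ring,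
          Or.inr (by linarith), Or.inl ?_⟩
        rcases hb with hb | hb
        · omega
        · linarith
      · rw [if_neg hc] at h1
        have h3 : h (n + 1) = h n := by rw [h2, h1]; ring
        rw [h3, h1]
        exact ⟨k, by omega, by ring, hn, ha, Or.inr (not_le.mp hc)⟩
  obtain ⟨k, hk, hsum, hn, ha, hb⟩ := key D
  rw [hsum]
  have hkD : (k : ℝ) ≤ D := by exact_mod_cast hk
  have hk0 : (0 : ℝ) ≤ k := Nat.cast_nonneg k
  have hf : ⌊min (max u 0) (D : ℝ) + 1 / 2⌋ = (k : ℤ) := by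
    rw [Int.floor_eq_iff]
    push_cast
    constructor
    · have : (k : ℝ) - 1 / 2 ≤ min (max u 0) (D : ℝ) := by
        refine le_min ?_ (by linarith)
        rcases ha with ha | ha
        · subst ha
          exact le_max_of_le_right (by norm_num)
        · exact le_max_of_le_left (by linarith)
      linarith
    · rcases hb with hb | hb
      · have := min_le_right (max u 0) (D : ℝ)
        rw [hb]
        linarith
      · have h4 := min_le_left (max u 0) (D : ℝ)
        have h5 : max u 0 < k + 1 / 2 := max_lt (by linarith) (by linarith)
        linarith
  rw [hf]
  simp
end
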